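/- For every set D of d edge failures and all vertices u, v that are connected in G−D, the shortest path π_{G−D}(u,v) is a d-decomposable path; that is, it is the concatenation of at most d+1 shortest paths of G, interleaved with at most d single edges. -/

import Mathlib

open SimpleGraph

variable {V : Type*}

/-- Total weight of a walk with respect to edge weights `w`. -/
def walkWeight (w : Sym2 V → ℝ) {G : SimpleGraph V} {a b : V} (p : G.Walk a b) : ℝ :=
  (p.edges.map w).sum

/-- `p` is the/a minimum-weight path from `a` to `b` in `G`. -/
def IsShortestPath (w : Sym2 V → ℝ) (G : SimpleGraph V) {a b : V} (p : G.Walk a b) : Prop :=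
  p.IsPath ∧ ∀ q : G.Walk a b, q.IsPath → walkWeight w p ≤ walkWeight w q

/-- `Decomposable w G k p` : `p` is the concatenation of at most `k+1` shortest paths
of `G` interleaved with at most `k` single edges. -/
inductive Decomposable (w : Sym2 V → ℝ) (G : SimpleGraph V) :
    ℕ → ∀ {a b : V}, G.Walk a b → Prop
  | single {a b : V} (k : ℕ) (p : G.Walk a b) (hp : IsShortestPath w G p) :
      Decomposable w G k p
  | cons {a b c d : V} (k : ℕ) (p : G.Walk a b) (h : G.Adj b c) (q : G.Walk c d)
      (hp : IsShortestPath w G p) (hq : Decomposable w G k q) :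
      Decomposable w G (k + 1) (p.append (Walk.cons h q))

/-- The rank of a walk `p` in `G`: the least `k` such that `p` is `k`-decomposable. -/
noncomputable def pathRank (w : Sym2 V → ℝ) (G : SimpleGraph V) {a b : V} (p : G.Walk a b) : ℕ :=
  sInf {k | Decomposable w G k p}

/-- `y` is the edge list of a walk strictly lighter than some walk with edge list `x` and the same
endpoints. -/
def IsDetour (w : Sym2 V → ℝ) (G : SimpleGraph V) (x y : List (Sym2 V)) : Prop :=
  ∃ (a b : V) (p q : G.Walk a b), p.edges = x ∧ q.edges = y ∧ walkWeight w q < walkWeight w p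

/-- The coboundary modulo two of a function on the vertices. -/
def coboundary (f : V → ZMod 2) : Sym2 V → ZMod 2 :=
  Sym2.lift ⟨fun a b => f a + f b, fun a b => add_comm (f a) (f b)⟩

theorem sum_coboundary_edges (f : V → ZMod 2) {G : SimpleGraph V} {a b : V} (p : G.Walk a b) :
    (p.edges.map (coboundary f)).sum = f a + f b := by
  induction p with
  | nil => simp [CharTwo.add_self_eq_zero]
  | @cons a b c h p ih =>
    have hb : f b + f b = 0 := CharTwo.add_self_eq_zero _
    rw [Walk.edges_cons, List.map_cons, List.sum_cons, ih, coboundary, Sym2.lift_mk]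
    linear_combination hb

theorem isShortestPath_nil {G : SimpleGraph V} {w : Sym2 V → ℝ}
    (hw : ∀ e ∈ G.edgeSet, 0 < w e) (a : V) : IsShortestPath w G (Walk.nil : G.Walk a a) := by
  refine ⟨Walk.IsPath.nil, fun q _ => ?_⟩
  simp only [walkWeight, Walk.edges_nil, List.map_nil, List.sum_nil]
  refine List.sum_nonneg fun x hx => ?_
  obtain ⟨e, he, rfl⟩ := List.mem_map.1 hx
  exact (hw e (q.edges_subset_edgeSet he)).le

theorem isDetour_of_not_isShortestPath {G : SimpleGraph V} {w : Sym2 V → ℝ} {a b : V}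
    {p : G.Walk a b} (hp : p.IsPath) (h : ¬ IsShortestPath w G p) :
    ∃ y, IsDetour w G p.edges y := by
  simp only [IsShortestPath, not_and, not_forall, not_le] at h
  obtain ⟨q, -, hq⟩ := h hp
  exact ⟨q.edges, a, b, p, q, rfl, rfl, hq⟩

/-- A path that is not shortest has a maximal shortest prefix. -/
theorem exists_maximal_shortest_prefix {G : SimpleGraph V} {w : Sym2 V → ℝ}
    (hw : ∀ e ∈ G.edgeSet, 0 < w e) {a b : V} (p : G.Walk a b) (h : ¬ IsShortestPath w G p) :
    ∃ (x y : V) (q : G.Walk a x) (hxy : G.Adj x y) (r : G.Walk y b),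
      p = q.append (Walk.cons hxy r) ∧ IsShortestPath w G q ∧
        ¬ IsShortestPath w G (q.concat hxy) := by
  induction p using Walk.concatRec with
  | Hnil => exact absurd (isShortestPath_nil hw _) h
  | @Hconcat a b c p hbc ih =>
    by_cases hp : IsShortestPath w G p
    · exact ⟨_, _, p, hbc, Walk.nil, rfl, hp, h⟩
    · obtain ⟨x, y, q, hxy, r, rfl, hq, hn⟩ := ih hp
      refine ⟨x, y, q, hxy, r.concat hbc, ?_, hq, hn⟩
      rw [Walk.concat_eq_append, Walk.concat_eq_append, ← Walk.append_assoc, Walk.cons_append]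

theorem decomposable_or_exists_detours {G : SimpleGraph V} {w : Sym2 V → ℝ}
    (hw : ∀ e ∈ G.edgeSet, 0 < w e) (k : ℕ) {a b : V} (p : G.Walk a b) (hp : p.IsPath) :
    Decomposable w G k p ∨ ∃ (S T : Fin (k + 1) → List (Sym2 V)) (r : List (Sym2 V)),
      p.edges = (List.ofFn S).flatten ++ r ∧ ∀ i, IsDetour w G (S i) (T i) := by
  by_cases hs : IsShortestPath w G p
  · exact Or.inl (.single k p hs)
  induction k generalizing a p with
  | zero =>
    obtain ⟨y, hy⟩ := isDetour_of_not_isShortestPath hp hs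
    exact Or.inr ⟨fun _ => p.edges, fun _ => y, [], by simp, fun _ => hy⟩
  | succ k ih =>
    obtain ⟨x, y, q, hxy, r, rfl, hq, hn⟩ := exists_maximal_shortest_prefix hw p hs
    have hr : r.IsPath := hp.of_append_right.of_cons
    have hqc : (q.concat hxy).IsPath := by
      rw [← Walk.concat_append] at hp
      exact hp.of_append_left
    have key : Decomposable w G k r ∨ ∃ (S T : Fin (k + 1) → List (Sym2 V)) (l : List (Sym2 V)),
        r.edges = (List.ofFn S).flatten ++ l ∧ ∀ i, IsDetour w G (S i) (T i) := by
      by_cases hrs : IsShortestPath w G r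
      · exact Or.inl (.single k r hrs)
      · exact ih r hr hrs
    rcases key with hd | ⟨S, T, l, hl, hST⟩
    · exact Or.inl (.cons k q hxy r hq hd)
    · obtain ⟨t, ht⟩ := isDetour_of_not_isShortestPath hqc hn
      refine Or.inr ⟨Fin.cons (q.concat hxy).edges S, Fin.cons t T, l, ?_, ?_⟩
      · simp [List.ofFn_succ, Walk.edges_append, Walk.edges_concat, hl]
      · exact Fin.cases ht hST

/-- If the edges of odd multiplicity in `M` lie in `H` and the boundary of `M` modulo two is
`{u, v}`, then some `u`–`v` path of `H` weighs at most as much as `M`. -/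
theorem exists_isPath_walkWeight_le [DecidableEq V] {H : SimpleGraph V} {w : Sym2 V → ℝ} {u v : V}
    (M : List (Sym2 V)) (hM : ∀ e ∈ M, 0 ≤ w e)
    (hH : ∀ e, (M.count e : ZMod 2) ≠ 0 → e ∈ H.edgeSet)
    (hbd : ∀ f : V → ZMod 2, (M.map (coboundary f)).sum = f u + f v) :
    ∃ p : H.Walk u v, p.IsPath ∧ walkWeight w p ≤ (M.map w).sum := by
  classical
  let K : SimpleGraph V := fromEdgeSet {e | (M.count e : ZMod 2) ≠ 0}
  have hKmem : ∀ e ∈ K.edgeSet, (M.count e : ZMod 2) ≠ 0 := fun e he => by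
    simp only [K, edgeSet_fromEdgeSet] at he
    exact he.1
  have hKH : K ≤ H := fun a b hab => hH _ (hKmem s(a, b) hab)
  have hreach : K.Reachable u v := by
    let f : V → ZMod 2 := fun x => if K.Reachable u x then 1 else 0
    have hzero : (M.map (coboundary f)).sum = 0 := by
      rw [Finset.sum_list_map_count]
      refine Finset.sum_eq_zero fun e _ => ?_
      rw [nsmul_eq_mul]
      by_cases hc : (M.count e : ZMod 2) = 0
      · rw [hc, zero_mul]
      · induction e with
        | _ a b =>
          have hab : K.Adj a b := by
            rw [fromEdgeSet_adj]
            exact ⟨hc, (hH _ hc : H.Adj a b).ne⟩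
          have hiff : K.Reachable u a ↔ K.Reachable u b :=
            ⟨fun h => h.trans hab.reachable, fun h => h.trans hab.symm.reachable⟩
          have hf : f a = f b := by simp only [f, hiff]
          simp only [coboundary, Sym2.lift_mk, hf, CharTwo.add_self_eq_zero, mul_zero]
    by_contra hv
    have := hbd f
    simp [hzero, f, hv] at this
  obtain ⟨p, hp⟩ := hreach.exists_isPath
  refine ⟨p.mapLe hKH, (Walk.isPath_mapLe hKH).2 hp, ?_⟩
  have hsub : p.edges ⊆ M := fun e he => by
    by_contra hn
    exact hKmem e (p.edges_subset_edgeSet he) (by simp [List.count_eq_zero_of_not_mem hn])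
  obtain ⟨m, hm, hmM⟩ := List.subperm_of_subset hp.isTrail.edges_nodup hsub
  obtain ⟨l, hml⟩ := hmM.exists_perm_append
  have hl := hml.trans (hm.append_right l)
  have hsum := (hl.map w).sum_eq
  have hl0 : 0 ≤ (l.map w).sum := by
    refine List.sum_nonneg fun x hx => ?_
    obtain ⟨e, he, rfl⟩ := List.mem_map.1 hx
    exact hM e (hl.mem_iff.2 (List.mem_append_right _ he))
  rw [List.map_append, List.sum_append] at hsum
  rw [walkWeight, Walk.edges_mapLe_eq_edges, hsum]
  linarith

theorem exists_ne_zero_sum_mul_eq_zero {K : Type*} [Field K] {ι κ : Type*} [Fintype ι] [Fintype κ]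
    (h : Fintype.card κ < Fintype.card ι) (c : ι → κ → K) :
    ∃ g : ι → K, g ≠ 0 ∧ ∀ j, ∑ i, g i * c i j = 0 := by
  have hker : LinearMap.ker (Fintype.linearCombination K c) ≠ ⊥ :=
    LinearMap.ker_ne_bot_of_finrank_lt (by simpa using h)
  obtain ⟨g, hg, hg0⟩ := Submodule.exists_mem_ne_zero_of_ne_bot hker
  refine ⟨g, hg0, fun j => ?_⟩
  have := congrFun (LinearMap.mem_ker.1 hg) j
  simpa [Fintype.linearCombination_apply, Finset.sum_apply] using this

theorem sum_map_flatten_ofFn_append {α M : Type*} [AddCommMonoid M] (f : α → M) {n : ℕ}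
    (L : Fin n → List α) (r : List α) :
    (((List.ofFn L).flatten ++ r).map f).sum = ∑ i, ((L i).map f).sum + (r.map f).sum := by
  rw [List.map_append, List.sum_append, List.map_flatten, List.sum_flatten, List.map_map,
    List.map_ofFn, List.sum_ofFn]
  rfl

/-- Theorem 2 of [ABKCM02].  For every set `D` of `d` edge failures and
all vertices `u, v` connected in `G − D` (witnessed by the shortest path `P`), the shortest
path `π_{G−D}(u,v)` is a `d`-decomposable path: the concatenation of at most `d+1` shortest
paths of `G` interleaved with at most `d` single edges. -/
theorem stmt0 [Fintype V] [DecidableEq V] (G : SimpleGraph V) (w : Sym2 V → ℝ)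
    -- positive edge weights
    (hw : ∀ e ∈ G.edgeSet, 0 < w e)
    -- shortest paths in G are unique
    (huniqG : ∀ (a b : V) (p q : G.Walk a b),
      IsShortestPath w G p → IsShortestPath w G q → p = q)
    (d : ℕ) (D : Finset (Sym2 V)) (hDsub : ↑D ⊆ G.edgeSet) (hDcard : D.card = d)
    -- shortest paths in G − D are unique
    (huniqD : ∀ (a b : V) (p q : (G.deleteEdges ↑D).Walk a b),
      IsShortestPath w (G.deleteEdges ↑D) p → IsShortestPath w (G.deleteEdges ↑D) q → p = q)
    (u v : V) (P : (G.deleteEdges ↑D).Walk u v)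
    (hP : IsShortestPath w (G.deleteEdges ↑D) P) :
    Decomposable w G d (P.mapLe (SimpleGraph.deleteEdges_le (↑D : Set (Sym2 V)))) := by
  have hDD : ∀ e ∈ D, e ∉ P.edges := fun e he heP => by
    have := P.edges_subset_edgeSet heP
    rw [edgeSet_deleteEdges] at this
    exact this.2 he
  have hle := SimpleGraph.deleteEdges_le (G := G) (↑D : Set (Sym2 V))
  have hPG : ∀ e ∈ P.edges, e ∈ G.edgeSet := fun e he =>
    edgeSet_mono hle (P.edges_subset_edgeSet he)
  refine (decomposable_or_exists_detours hw d _
    ((Walk.isPath_mapLe hle).2 hP.1)).resolve_right ?_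
  rintro ⟨S, T, r, hPe, hST⟩
  rw [Walk.edges_mapLe_eq_edges] at hPe
  have hSP : ∀ i, ∀ e ∈ S i, e ∈ P.edges := fun i e he => by
    rw [hPe]
    exact List.mem_append_left _
      (List.mem_flatten.2 ⟨S i, (List.mem_ofFn' S (S i)).2 ⟨i, rfl⟩, he⟩)
  have hrP : ∀ e ∈ r, e ∈ P.edges := fun e he => by
    rw [hPe]
    exact List.mem_append_right _ he
  obtain ⟨g, hg0, hg⟩ := exists_ne_zero_sum_mul_eq_zero (K := ZMod 2) (ι := Fin (d + 1)) (κ := D)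
    (by simp [hDcard]) (fun i e => ((T i).count (e : Sym2 V) : ZMod 2))
  let L : Fin (d + 1) → List (Sym2 V) := fun i => if g i = 0 then S i else T i
  let M := (List.ofFn L).flatten ++ r
  have hLG : ∀ i, ∀ e ∈ L i, e ∈ G.edgeSet := fun i e he => by
    simp only [L] at he
    split_ifs at he
    · exact hPG e (hSP i e he)
    · obtain ⟨a, b, p, q, -, hq, -⟩ := hST i
      exact q.edges_subset_edgeSet (hq ▸ he)
  have hMG : ∀ e ∈ M, e ∈ G.edgeSet := fun e he => by
    rcases List.mem_append.1 he with he | he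
    · obtain ⟨l, hl, he⟩ := List.mem_flatten.1 he
      obtain ⟨i, rfl⟩ := (List.mem_ofFn' L l).1 hl
      exact hLG i e he
    · exact hPG e (hrP e he)
  have hcount : ∀ e ∈ D, (M.count e : ZMod 2) = 0 := fun e he => by
    have hr0 : r.count e = 0 := List.count_eq_zero_of_not_mem fun h => hDD e he (hrP e h)
    have hL : ∀ i, ((L i).count e : ZMod 2) = g i * (T i).count e := fun i => by
      by_cases hgi : g i = 0
      · have : (S i).count e = 0 := List.count_eq_zero_of_not_mem fun h => hDD e he (hSP i e h)
        simp [L, hgi, this]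
      · have : g i = 1 := Fin.eq_one_of_ne_zero (g i) hgi
        simp [L, this]
    have hM : M.count e = ∑ i, (L i).count e := by
      simp only [M]
      rw [List.count_append, hr0, add_zero, List.count_flatten, List.map_ofFn, List.sum_ofFn]
      rfl
    rw [hM, Nat.cast_sum, Finset.sum_congr rfl fun i _ => hL i]
    exact hg ⟨e, he⟩
  have hbd : ∀ f : V → ZMod 2, (M.map (coboundary f)).sum = f u + f v := fun f => by
    rw [← sum_coboundary_edges f P, hPe, sum_map_flatten_ofFn_append, sum_map_flatten_ofFn_append]
    congr 1
    refine Finset.sum_congr rfl fun i _ => ?_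
    obtain ⟨a, b, p, q, hp, hq, -⟩ := hST i
    simp only [L]
    split_ifs
    · rfl
    · rw [← hp, ← hq, sum_coboundary_edges, sum_coboundary_edges]
  have hlt : (M.map w).sum < walkWeight w P := by
    rw [walkWeight, hPe, sum_map_flatten_ofFn_append, sum_map_flatten_ofFn_append]
    have hTS : ∀ i, ((T i).map w).sum < ((S i).map w).sum := fun i => by
      obtain ⟨a, b, p, q, hp, hq, hpq⟩ := hST i
      rwa [← hp, ← hq]
    obtain ⟨j, hj⟩ := Function.ne_iff.1 hg0
    refine add_lt_add_left (Finset.sum_lt_sum (fun i _ => ?_) ⟨j, Finset.mem_univ j, ?_⟩) _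
    · simp only [L]
      split_ifs
      · exact le_rfl
      · exact (hTS i).le
    · simp only [L, if_neg (show ¬ g j = 0 from hj)]
      exact hTS j
  obtain ⟨p, hp, hpw⟩ := exists_isPath_walkWeight_le (H := G.deleteEdges ↑D) M
    (fun e he => (hw e (hMG e he)).le)
    (fun e he => by
      rw [edgeSet_deleteEdges]
      refine ⟨hMG e ?_, fun heD => he (hcount e heD)⟩
      by_contra hn
      exact he (by simp [List.count_eq_zero_of_not_mem hn]))
    hbd
  exact absurd (hP.2 p hp) (not_le.2 (hpw.trans_lt hlt))
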